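/- arXiv:1212.6102 — 3 statements merged into one kernel-verified Lean document; each statement's English description precedes it below -/
import Mathlib

section
/- Let S be a finite nonempty sequence with curling number k. Among all representations S = X Y^k with Y nonempty (and X possibly empty), the shortest such Y is unique and primitive. Moreover, if k > 1 then this shortest Y has curling number strictly less than k, and if k = 1 then it has curling number 1. -/
/-- `listPow Y k` is the sequence `Y` repeated `k` times (i.e. `Y^k`). -/
def listPow {α : Type*} (Y : List α) : ℕ → List α
  | 0 => []
  | k + 1 => Y ++ listPow Y k

/-- The curling number of a finite sequence `S`: the largest `k` such that
`S = X ++ Y^k` for some (possibly empty) `X` and nonempty `Y`. -/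
noncomputable def CN {α : Type*} (S : List α) : ℕ :=
  sSup {k | ∃ X Y : List α, Y ≠ [] ∧ S = X ++ listPow Y k}

/-- A nonempty sequence is primitive if it is not a power `T^i` with `i ≥ 2`. -/
def Primitive {α : Type*} (S : List α) : Prop :=
  S ≠ [] ∧ ∀ (T : List α) (i : ℕ), 2 ≤ i → S ≠ listPow T i

/-- `T` is a proper suffix of `S`: a suffix which is strictly shorter than `S`. -/
def ProperSuffix {α : Type*} (T S : List α) : Prop := T <:+ S ∧ T.length < S.length

/-- A sequence `S` with curling number `k` is robust if no proper suffix of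
`S^(k+1)` has curling number `≥ k + 1`. -/
def Robust {α : Type*} (S : List α) : Prop :=
  ∀ T : List α, ProperSuffix T (listPow S (CN S + 1)) → CN T ≤ CN S

theorem length_listPow {α : Type*} (Y : List α) (k : ℕ) :
    (listPow Y k).length = k * Y.length := by
  induction k with
  | zero => simp [listPow]
  | succ k ih => simp [listPow, ih]; ring

theorem listPow_add {α : Type*} (Y : List α) (m n : ℕ) :
    listPow Y (m + n) = listPow Y m ++ listPow Y n := by
  induction m with
  | zero => simp [listPow]
  | succ m ih => rw [Nat.succ_add]; simp [listPow, ih]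

theorem listPow_mul {α : Type*} (Y : List α) (m n : ℕ) :
    listPow Y (m * n) = listPow (listPow Y m) n := by
  induction n with
  | zero => simp [listPow]
  | succ n ih => rw [Nat.mul_succ, Nat.add_comm, listPow_add, ih, listPow]

theorem suffix_listPow {α : Type*} (Y : List α) {k : ℕ} (hk : 1 ≤ k) :
    Y <:+ listPow Y k := by
  obtain ⟨n, rfl⟩ := Nat.exists_eq_add_of_le' hk
  exact ⟨listPow Y n, by rw [listPow_add]; simp [listPow]⟩

theorem bddAbove_curling {α : Type*} (S : List α) :
    BddAbove {k | ∃ X Y : List α, Y ≠ [] ∧ S = X ++ listPow Y k} := by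
  refine ⟨S.length, ?_⟩
  rintro k ⟨X, Y, hY, rfl⟩
  have := List.length_pos_iff.2 hY
  simp only [List.length_append, length_listPow]
  nlinarith

theorem le_CN {α : Type*} {S Y : List α} {k : ℕ} (hY : Y ≠ []) (h : listPow Y k <:+ S) :
    k ≤ CN S := by
  obtain ⟨X, rfl⟩ := h
  exact le_csSup (bddAbove_curling _) ⟨X, Y, hY, rfl⟩

theorem one_le_CN {α : Type*} {S : List α} (hS : S ≠ []) : 1 ≤ CN S :=
  le_CN hS (by simp [listPow])

theorem exists_eq_append_listPow_CN {α : Type*} {S : List α} (hS : S ≠ []) :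
    ∃ X Y : List α, Y ≠ [] ∧ S = X ++ listPow Y (CN S) :=
  Nat.sSup_mem (s := {k | ∃ X Y : List α, Y ≠ [] ∧ S = X ++ listPow Y k})
    ⟨1, [], S, hS, by simp [listPow]⟩ (bddAbove_curling S)

theorem CN_le_of_suffix {α : Type*} {T S : List α} (hT : T ≠ []) (h : T <:+ S) :
    CN T ≤ CN S := by
  obtain ⟨X, Y, hY, hTY⟩ := exists_eq_append_listPow_CN hT
  exact le_CN hY (.trans ⟨X, hTY.symm⟩ h)

/-- Among all representations `S = X ++ Y^(CN S)` with `Y` nonempty, the shortest such `Y`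
is unique and primitive; moreover it has curling number `< CN S` when `CN S > 1`,
and curling number `1` when `CN S = 1`. -/
theorem shortest_Y_unique_primitive {α : Type*} (S : List α) (hS : S ≠ []) :
    ∃ Y₀ X₀ : List α, Y₀ ≠ [] ∧ S = X₀ ++ listPow Y₀ (CN S) ∧
      (∀ X Y : List α, Y ≠ [] → S = X ++ listPow Y (CN S) → Y₀.length ≤ Y.length) ∧
      (∀ X Y : List α, Y ≠ [] → S = X ++ listPow Y (CN S) →
        Y.length = Y₀.length → Y = Y₀) ∧
      Primitive Y₀ ∧
      (1 < CN S → CN Y₀ < CN S) ∧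
      (CN S = 1 → CN Y₀ = 1) := by
  classical
  have hk := one_le_CN hS
  have hex : ∃ n, ∃ X Y : List α, Y ≠ [] ∧ S = X ++ listPow Y (CN S) ∧ Y.length = n := by
    obtain ⟨X, Y, hY, h⟩ := exists_eq_append_listPow_CN hS
    exact ⟨_, X, Y, hY, h, rfl⟩
  obtain ⟨X₀, Y₀, hY₀, hS₀, hlen⟩ := Nat.find_spec hex
  have hmin : ∀ X Y : List α, Y ≠ [] → S = X ++ listPow Y (CN S) → Y₀.length ≤ Y.length :=
    fun X Y hY h => hlen ▸ Nat.find_min' hex ⟨X, Y, hY, h, rfl⟩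
  have hsuffix : ∀ {X Y : List α}, S = X ++ listPow Y (CN S) → Y <:+ S :=
    fun {X Y} h => (suffix_listPow Y hk).trans ⟨X, h.symm⟩
  have hle : CN Y₀ ≤ CN S := CN_le_of_suffix hY₀ (hsuffix hS₀)
  refine ⟨Y₀, X₀, hY₀, hS₀, hmin, fun X Y _ h hl => ?_, ⟨hY₀, fun T i hi h => ?_⟩,
    fun h1 => ?_, fun h1 => le_antisymm (h1 ▸ hle) (one_le_CN hY₀)⟩
  · exact (List.suffix_of_suffix_length_le (hsuffix h) (hsuffix hS₀) hl.le).eq_of_length hl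
  · have hT : T ≠ [] := by
      rintro rfl
      apply hY₀
      rw [← List.length_eq_zero_iff, h, length_listPow]
      simp
    have hpow : i * CN S ≤ CN S :=
      le_CN hT ⟨X₀, by rw [listPow_mul, ← h]; exact hS₀.symm⟩
    nlinarith
  · refine lt_of_le_of_ne hle fun heq => ?_
    obtain ⟨X, Z, hZ, hYZ⟩ := exists_eq_append_listPow_CN hY₀
    rw [heq] at hYZ
    obtain ⟨W, hW⟩ := (List.IsSuffix.trans ⟨X, hYZ.symm⟩ (hsuffix hS₀) : listPow Z (CN S) <:+ S)
    have hYle := hmin W Z hZ hW.symm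
    have hYlen := congrArg List.length hYZ
    rw [List.length_append, length_listPow] at hYlen
    have hZpos := List.length_pos_iff.2 hZ
    nlinarith
end

section
/- Suppose S is a finite nonempty sequence with CN(S) = 1, and T is a proper suffix of S with CN(TS) > 1. Then there exist nonempty sequences X and Y such that S = XYX, CN(X) = 1, Y is a suffix of T, and Y is a proper suffix of X. -/
theorem listPow_succ_right {α : Type*} (Y : List α) (k : ℕ) :
    listPow Y (k + 1) = listPow Y k ++ Y := by
  induction k with
  | zero => simp [listPow]
  | succ k ih =>
    change Y ++ listPow Y (k + 1) = Y ++ listPow Y k ++ Y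
    rw [ih, List.append_assoc]

/-- The curling number exceeds one exactly when the sequence ends in a square. -/
theorem one_lt_CN_iff {α : Type*} (S : List α) :
    1 < CN S ↔ ∃ Z : List α, Z ≠ [] ∧ Z ++ Z <:+ S := by
  constructor
  · intro h
    have hne : {k | ∃ X Y : List α, Y ≠ [] ∧ S = X ++ listPow Y k}.Nonempty := by
      by_contra hempty
      rw [Set.not_nonempty_iff_eq_empty] at hempty
      simp [CN, hempty] at h
    obtain ⟨k, ⟨X, Y, hY, hS⟩, hk⟩ := exists_lt_of_lt_csSup hne h
    obtain ⟨m, rfl⟩ := Nat.exists_eq_add_of_le' hk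
    refine ⟨Y, hY, X ++ listPow Y m, ?_⟩
    rw [hS, Nat.succ_eq_add_one, ← Nat.add_assoc, listPow_succ_right, listPow_succ_right]
    simp
  · rintro ⟨Z, hZ, A, hA⟩
    exact le_csSup (bddAbove_curling S) ⟨A, Z, hZ, by simp [listPow, hA]⟩

/-- If `CN S = 1` but `CN (T S) > 1` for some proper suffix `T` of `S`, then `S = X Y X`
with `X, Y` nonempty, `CN X = 1`, `Y` a suffix of `T`, and `Y` a proper suffix of `X`. -/
theorem nonrobust_canonical_form {α : Type*} (S T : List α) (hS : S ≠ [])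
    (hCN : CN S = 1) (hT : ProperSuffix T S) (hTS : 1 < CN (T ++ S)) :
    ∃ X Y : List α, X ≠ [] ∧ Y ≠ [] ∧ S = X ++ Y ++ X ∧ CN X = 1 ∧
      Y <:+ T ∧ ProperSuffix Y X := by
  have hsq : ∀ Z : List α, Z ≠ [] → ¬ Z ++ Z <:+ S := fun Z hZ hsuff =>
    absurd ((one_lt_CN_iff S).mpr ⟨Z, hZ, hsuff⟩) (by omega)
  obtain ⟨Z, hZ, hZZ⟩ := (one_lt_CN_iff _).mp hTS
  obtain ⟨hTsuff, hTlen⟩ := hT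
  have hS_TS : S <:+ T ++ S := List.suffix_append T S
  have hlen := hZZ.length_le
  simp only [List.length_append] at hlen
  have hZS : Z <:+ S :=
    List.suffix_of_suffix_length_le ((List.suffix_append Z Z).trans hZZ) hS_TS (by omega)
  obtain ⟨X, rfl⟩ := hZS
  have hlt : X.length < Z.length := by
    by_contra! hle
    refine hsq Z hZ (List.suffix_of_suffix_length_le hZZ hS_TS ?_)
    simpa using hle
  have hXZ : X <:+ Z := by
    have hXZZ : X ++ Z <:+ Z ++ Z :=
      List.suffix_of_suffix_length_le hS_TS hZZ (by simpa using hlt.le)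
    exact (List.suffix_append_self_iff).mp hXZZ
  obtain ⟨Y, rfl⟩ := hXZ
  simp only [List.length_append] at hlen hlt hTlen
  have hX : X ≠ [] := by
    rintro rfl
    simp at hlen hTlen
    omega
  have hY : Y ≠ [] := by
    rintro rfl
    simp at hlt
  have hYT : Y <:+ T := by
    obtain ⟨A, hA⟩ := hZZ
    refine ⟨A, List.append_cancel_right (bs := X ++ (Y ++ X)) ?_⟩
    simpa using hA
  have hX_S : X <:+ X ++ (Y ++ X) := ⟨X ++ Y, by simp⟩
  have hY_S := hYT.trans hTsuff
  have hYX : Y.length < X.length := by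
    by_contra! hle
    obtain ⟨W, rfl⟩ := List.suffix_of_suffix_length_le hX_S hY_S hle
    exact hsq X hX ⟨X ++ W, by simp⟩
  refine ⟨X, Y, hX, hY, by simp, le_antisymm ?_ (one_le_CN hX), hYT,
    List.suffix_of_suffix_length_le hY_S hX_S hYX.le, hYX⟩
  by_contra! hgt
  obtain ⟨V, hV, hVV⟩ := (one_lt_CN_iff X).mp hgt
  exact hsq V hV (hVV.trans hX_S)
end

section
/- For integers n and i with n/3 ≤ i < n, a(n,i) = c(n,1) − Σ_{m = 1+⌊n/3⌋}^{⌊(n−1)/2⌋} b(m, n−2m). -/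
/-- `c(n,k)`: the number of binary sequences of length `n` with curling number `k`. -/
noncomputable def cCount (n k : ℕ) : ℕ :=
  {S : List Bool | S.length = n ∧ CN S = k}.ncard

/-- `p(n,k)`: the number of primitive binary sequences of length `n` with curling number `k`. -/
noncomputable def pCount (n k : ℕ) : ℕ :=
  {S : List Bool | S.length = n ∧ CN S = k ∧ Primitive S}.ncard

/-- `p'(n,k)`: the number of primitive robust binary sequences of length `n`
with curling number `k`. -/
noncomputable def pCount' (n k : ℕ) : ℕ :=
  {S : List Bool | S.length = n ∧ CN S = k ∧ Primitive S ∧ Robust S}.ncard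

/-- `q(n,k) = Σ_{i=1}^{k} p(n,i)`. -/
noncomputable def qCount (n k : ℕ) : ℕ := ∑ i ∈ Finset.Icc 1 k, pCount n i

/-- `S^{[i]}`: the suffix of `S` of length `i`. -/
def suffLen {α : Type*} (S : List α) (i : ℕ) : List α := S.drop (S.length - i)

/-- `A(n,i)`: binary sequences `S` of length `n` with `CN S = 1` and `CN (S^{[i]} S) = 1`. -/
def setA (n i : ℕ) : Set (List Bool) :=
  {S | S.length = n ∧ CN S = 1 ∧ CN (suffLen S i ++ S) = 1}

/-- `B(n,i)`: binary sequences `S` of length `n` with `CN S = 1` and `CN (S S^{[i]} S) = 1`. -/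
def setB (n i : ℕ) : Set (List Bool) :=
  {S | S.length = n ∧ CN S = 1 ∧ CN (S ++ suffLen S i ++ S) = 1}

/-- `E(n,i,j)`: binary sequences `S` of length `n` with `CN S = 1`
and `S^{[i]} S ∈ B(n+i, j)`. -/
def setE (n i j : ℕ) : Set (List Bool) :=
  {S | S.length = n ∧ CN S = 1 ∧ (suffLen S i ++ S) ∈ setB (n + i) j}

noncomputable def aCount (n i : ℕ) : ℕ := (setA n i).ncard
noncomputable def bCount (n i : ℕ) : ℕ := (setB n i).ncard
noncomputable def eCount (n i j : ℕ) : ℕ := (setE n i j).ncard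

theorem le_length_listPow {α : Type*} {Y : List α} (hY : Y ≠ []) (k : ℕ) :
    k ≤ (listPow Y k).length := by
  induction k with
  | zero => simp
  | succ k ih =>
    have := List.length_pos_iff.mpr hY
    simp only [listPow, List.length_append]
    omega

/-- A sequence has curling number one iff it is nonempty and does not end in a square. -/
theorem CN_eq_one_iff {α : Type*} (S : List α) :
    CN S = 1 ↔ S ≠ [] ∧ ∀ Y : List α, Y ≠ [] → ¬ (Y ++ Y <:+ S) := by
  have hbdd : BddAbove {k | ∃ X Y : List α, Y ≠ [] ∧ S = X ++ listPow Y k} := by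
    refine ⟨S.length, ?_⟩
    rintro k ⟨X, Y, hY, rfl⟩
    have := le_length_listPow hY k
    simp only [List.length_append]
    omega
  constructor
  · intro h
    constructor
    · rintro rfl
      have hmem : CN ([] : List α) ∈ {k | ∃ X Y : List α, Y ≠ [] ∧ [] = X ++ listPow Y k} := by
        refine Nat.sSup_mem ?_ hbdd
        by_contra hne
        rw [Set.not_nonempty_iff_eq_empty] at hne
        rw [CN, hne] at h
        simp at h
      obtain ⟨X, Y, hY, hXY⟩ := hmem
      rw [h] at hXY
      simp [listPow, hY] at hXY
    · rintro Y hY ⟨X, hX⟩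
      have h2 : 2 ≤ CN S := le_csSup hbdd ⟨X, Y, hY, by simp [listPow, ← hX]⟩
      omega
  · rintro ⟨hS, hsq⟩
    apply le_antisymm
    · refine csSup_le ⟨1, [], S, hS, by simp [listPow]⟩ ?_
      rintro k ⟨X, Y, hY, hk⟩
      by_contra! hlt
      obtain ⟨j, rfl⟩ : ∃ j, k = j + 2 := ⟨k - 2, by omega⟩
      have hcomm : ∀ j, Y ++ listPow Y j = listPow Y j ++ Y := by
        intro j
        induction j with
        | zero => simp [listPow]
        | succ j ih => simp only [listPow, List.append_assoc, ← ih]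
      refine hsq Y hY ⟨X ++ listPow Y j, ?_⟩
      simp only [hk, listPow, List.append_assoc]
      rw [hcomm j, ← List.append_assoc (listPow Y j), ← hcomm j, List.append_assoc, hcomm j]
    · exact le_csSup hbdd ⟨[], S, hS, by simp [listPow]⟩

theorem CN_eq_one_of_suffix {α : Type*} {S T : List α} (hT : T ≠ []) (h : T <:+ S)
    (hS : CN S = 1) : CN T = 1 := by
  rw [CN_eq_one_iff] at hS ⊢
  exact ⟨hT, fun Y hY hYT => hS.2 Y hY (hYT.trans h)⟩

theorem suffLen_suffix {α : Type*} (S : List α) (i : ℕ) : suffLen S i <:+ S :=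
  List.drop_suffix _ _

theorem length_suffLen {α : Type*} {S : List α} {i : ℕ} (h : i ≤ S.length) :
    (suffLen S i).length = i := by
  simp only [suffLen, List.length_drop]
  omega

theorem suffix_suffLen {α : Type*} {Q S : List α} {i : ℕ} (h : Q <:+ S) (hi : Q.length ≤ i) :
    Q <:+ suffLen S i := by
  rcases le_total i S.length with hle | hle
  · exact List.suffix_of_suffix_length_le h (suffLen_suffix S i) (by rwa [length_suffLen hle])
  · simpa [suffLen, Nat.sub_eq_zero_of_le hle] using h

theorem suffLen_length_of_suffix {α : Type*} {Q S : List α} (h : Q <:+ S) :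
    suffLen S Q.length = Q :=
  ((suffix_suffLen h le_rfl).eq_of_length (length_suffLen h.length_le).symm).symm

theorem exists_overlap_of_square_suffix {α : Type*} {S Y : List α} {i : ℕ} (hi : i < S.length)
    (hS : CN S = 1) (hY : Y ≠ []) (h : Y ++ Y <:+ suffLen S i ++ S) :
    ∃ P Q : List α, S = P ++ Q ++ P ∧ Q <:+ P ∧ Q ≠ [] ∧ Q.length < P.length := by
  rw [CN_eq_one_iff] at hS
  have hYS : S.length < (Y ++ Y).length := by
    by_contra! hle
    exact hS.2 Y hY (List.suffix_of_suffix_length_le h (List.suffix_append _ _) hle)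
  obtain ⟨Q, hQ⟩ := List.suffix_of_suffix_length_le (List.suffix_append (suffLen S i) S) h hYS.le
  have hQS : Q <:+ suffLen S i := by
    rw [← hQ] at h
    obtain ⟨X, hX⟩ := h
    exact ⟨X, List.append_cancel_right (by rw [List.append_assoc, hX])⟩
  have hlen := congrArg List.length hQ
  have hQi := hQS.length_le
  rw [length_suffLen hi.le] at hQi
  simp only [List.length_append] at hlen hYS
  obtain ⟨P, hP⟩ := List.suffix_of_suffix_length_le (List.suffix_append Y Y)
    (hQ ▸ List.suffix_append Q S) (by omega)
  have hYQP : Y = Q ++ P := by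
    apply List.append_cancel_right (bs := Y)
    rw [← hQ, List.append_assoc, hP]
  have hSP : S = P ++ Q ++ P := by rw [← hP, hYQP, List.append_assoc]
  have hPS : P <:+ S := ⟨P ++ Q, hSP.symm⟩
  have hQS' := hQS.trans (suffLen_suffix S i)
  have hQne : Q ≠ [] := by
    rintro rfl
    simp at hlen
    omega
  have hPne : P ≠ [] := by
    rintro rfl
    have := congrArg List.length hP
    simp only [List.length_append, List.length_nil] at this
    omega
  have hlt : Q.length < P.length := by
    by_contra! hle
    obtain ⟨V, hV⟩ := List.suffix_of_suffix_length_le hPS hQS' hle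
    exact hS.2 P hPne ⟨P ++ V, by rw [hSP, ← hV]; simp only [List.append_assoc]⟩
  exact ⟨P, Q, hSP, List.suffix_of_suffix_length_le hQS' hPS hlt.le, hQne, hlt⟩

theorem setOf_CN_eq_one_sdiff_setA {n i : ℕ} (h1 : n ≤ 3 * i) (h2 : i < n) :
    {S : List Bool | S.length = n ∧ CN S = 1} \ setA n i =
      ⋃ m ∈ Finset.Icc (n / 3 + 1) ((n - 1) / 2),
        (fun P => P ++ suffLen P (n - 2 * m) ++ P) '' setB m (n - 2 * m) := by
  ext S
  simp only [Set.mem_sdiff, Set.mem_ofPred_eq, setA, Set.mem_iUnion, Finset.mem_Icc, Set.mem_image,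
    setB, exists_prop]
  constructor
  · rintro ⟨⟨hn, hS⟩, hA⟩
    have hsq : ∃ Y : List Bool, Y ≠ [] ∧ Y ++ Y <:+ suffLen S i ++ S := by
      by_contra! hno
      refine hA ⟨hn, hS, (CN_eq_one_iff _).2 ⟨?_, hno⟩⟩
      have := ((CN_eq_one_iff _).1 hS).1
      simp [this]
    obtain ⟨Y, hY, hYS⟩ := hsq
    obtain ⟨P, Q, hSP, hQP, hQ, hlt⟩ :=
      exists_overlap_of_square_suffix (hn ▸ h2) hS hY hYS
    have hlen := congrArg List.length hSP
    have hQpos := List.length_pos_iff.mpr hQ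
    simp only [List.length_append, hn] at hlen
    have hQlen : n - 2 * P.length = Q.length := by omega
    refine ⟨P.length, by omega, P, ⟨rfl, ?_, ?_⟩, ?_⟩
    · refine CN_eq_one_of_suffix ?_ ⟨P ++ Q, hSP.symm⟩ hS
      rintro rfl
      simp at hlt
    · rw [hQlen, suffLen_length_of_suffix hQP, ← hSP, hS]
    · rw [hQlen, suffLen_length_of_suffix hQP, ← hSP]
  · rintro ⟨m, hm, P, ⟨rfl, hP, hPQP⟩, rfl⟩
    have hQlen : (suffLen P (n - 2 * P.length)).length = n - 2 * P.length :=
      length_suffLen (by omega)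
    have hQP := suffLen_suffix P (n - 2 * P.length)
    generalize suffLen P (n - 2 * P.length) = Q at *
    refine ⟨⟨by simp only [List.length_append]; omega, hPQP⟩, ?_⟩
    rintro ⟨-, -, hA⟩
    have hQS : Q <:+ P ++ Q ++ P := hQP.trans (List.suffix_append _ _)
    obtain ⟨X, hX⟩ := suffix_suffLen (i := i) hQS (by omega)
    refine ((CN_eq_one_iff _).1 hA).2 (Q ++ P) ?_ ⟨X, ?_⟩
    · rw [← List.length_pos_iff, List.length_append]
      omega
    · rw [← hX]
      simp only [List.append_assoc]

/-- Two borders of a sequence not ending in a square cannot have lengths within a factor two. -/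
theorem length_le_of_borders {α : Type*} {S P P' : List α} (hS : CN S = 1)
    (hP : P <:+ S) (hP' : P' <:+ S) (hpre : P <+: S) (hpre' : P' <+: S)
    (hlen : P'.length ≤ 2 * P.length) : P'.length ≤ P.length := by
  by_contra! hlt
  obtain ⟨R, hR⟩ := List.prefix_of_prefix_length_le hpre hpre' hlt.le
  have hPP' := List.suffix_of_suffix_length_le hP hP' hlt.le
  have hl := congrArg List.length hR
  simp only [List.length_append] at hl
  obtain ⟨V, hV⟩ := List.suffix_of_suffix_length_le ⟨P, hR⟩ hPP' (by omega)
  refine ((CN_eq_one_iff _).1 hS).2 R ?_ (List.IsSuffix.trans ⟨V, ?_⟩ hP')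
  · rintro rfl
    simp at hl
    omega
  · rw [← List.append_assoc, hV, hR]

theorem pairwiseDisjoint_image_setB (n : ℕ) :
    (Finset.Icc (n / 3 + 1) ((n - 1) / 2) : Set ℕ).PairwiseDisjoint
      (fun m => (fun P => P ++ suffLen P (n - 2 * m) ++ P) '' setB m (n - 2 * m)) := by
  intro m hm m' hm' hne
  refine Set.disjoint_left.2 ?_
  rintro S ⟨P, ⟨rfl, -, hS⟩, hPS⟩ ⟨P', ⟨rfl, -, -⟩, hPS'⟩
  simp only [Finset.coe_Icc, Set.mem_Icc] at hm hm' hPS hPS'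
  rw [hPS] at hS
  have hsuf : P <:+ S := hPS ▸ List.suffix_append _ _
  have hsuf' : P' <:+ S := hPS' ▸ List.suffix_append _ _
  have hpre : P <+: S := by rw [← hPS, List.append_assoc]; exact List.prefix_append _ _
  have hpre' : P' <+: S := by rw [← hPS', List.append_assoc]; exact List.prefix_append _ _
  exact hne (le_antisymm
    (length_le_of_borders hS hsuf' hsuf hpre' hpre (by omega))
    (length_le_of_borders hS hsuf hsuf' hpre hpre' (by omega)))

theorem injOn_append_suffLen_append {α : Type*} (m j : ℕ) :
    Set.InjOn (fun P : List α => P ++ suffLen P j ++ P) {P | P.length = m} := by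
  intro P hP P' hP' h
  simp only [List.append_assoc] at h
  exact (List.append_inj h (hP.trans hP'.symm)).1

theorem finite_setB (n j : ℕ) : (setB n j).Finite :=
  (List.finite_length_eq Bool n).subset fun _ h => h.1

/-- For `n/3 ≤ i < n`: `a(n,i) = c(n,1) - Σ_{m=1+⌊n/3⌋}^{⌊(n-1)/2⌋} b(m, n-2m)`. -/
theorem aCount_formula_large_i (n i : ℕ) (h1 : n ≤ 3 * i) (h2 : i < n) :
    (aCount n i : ℤ) = (cCount n 1 : ℤ) -
      ∑ m ∈ Finset.Icc (n / 3 + 1) ((n - 1) / 2), (bCount m (n - 2 * m) : ℤ) := by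
  have hfin : {S : List Bool | S.length = n ∧ CN S = 1}.Finite :=
    (List.finite_length_eq Bool n).subset fun _ h => h.1
  have hsub : setA n i ⊆ {S : List Bool | S.length = n ∧ CN S = 1} := fun S h => ⟨h.1, h.2.1⟩
  have hcard := Set.ncard_sdiff_add_ncard_of_subset hsub hfin
  have hunion := Set.Finite.ncard_biUnion (Finset.finite_toSet _)
    (fun m _ => (finite_setB m _).image _) (pairwiseDisjoint_image_setB n)
  rw [finsum_mem_coe_finset] at hunion
  simp only [Finset.mem_coe] at hunion
  rw [setOf_CN_eq_one_sdiff_setA h1 h2, hunion, Finset.sum_congr rfl fun m _ => Set.InjOn.ncard_image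
      ((injOn_append_suffLen_append m (n - 2 * m)).mono fun _ h => h.1)] at hcard
  rw [eq_sub_iff_add_eq']
  exact_mod_cast hcard
end
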